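/- arXiv:2110.03654 — 3 statements merged into one kernel-verified Lean document; each statement's English description precedes it below -/
import Mathlib

section
/- Let Γ be a looped graph and w, w₁, …, w_k ∈ X_Γ*. Let A be the bidirected valence system over Γ with two states s, t and the transitions s →w̄ t, t →w s, and t →w_i t, t →w̄_i t for each i ∈ [1,k]. Then [w] ∈ ⟨[w₁], …, [w_k]⟩ in the group MΓ if and only if there exists u ∈ X_Γ* with a run s →u t in A and [u] = 1. -/
open scoped Classical

/-- An undirected graph (finite in applications), with self-loops allowed:
`adj v v` means that `v` is looped. -/
structure GGraph (V : Type) where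
  adj : V → V → Prop
  symm : ∀ u v, adj u v → adj v u

namespace ValencePaper

variable {V Q : Type}

/-- The alphabet `X_Γ = V ∪ V̄`: `Sum.inl v` is the letter `v`,
`Sum.inr v` is the letter `v̄`. -/
abbrev XLetter (V : Type) := V ⊕ V

/-- Words over `X_Γ`. -/
abbrev GWord (V : Type) := List (XLetter V)

/-- The bar operation on letters, swapping `v` and `v̄`. -/
def barL : XLetter V → XLetter V := Sum.elim Sum.inr Sum.inl

/-- The inverse word `w̄`. -/
def barW (w : GWord V) : GWord V := (w.map barL).reverse

/-- The vertex a letter refers to. -/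
def vtx : XLetter V → V := Sum.elim id id

/-- One-step rewriting `s u t →_R s v t` for a set of rules `R`. -/
inductive RStep {α : Type} (R : Set (List α × List α)) : List α → List α → Prop
  | intro (s t : List α) {a b : List α} (h : (a, b) ∈ R) :
      RStep R (s ++ a ++ t) (s ++ b ++ t)

/-- The rule set `R_Γ`: cancellation `v v̄ → ε` and commutation `xy → yx`
for letters over adjacent vertices. -/
def GRules (Γ : GGraph V) : Set (GWord V × GWord V) :=
  {p | ∃ v : V, p = ([Sum.inl v, Sum.inr v], [])} ∪
  {p | ∃ (a b : V) (x y : XLetter V),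
      (x = Sum.inl a ∨ x = Sum.inr a) ∧ (y = Sum.inl b ∨ y = Sum.inr b) ∧
      Γ.adj a b ∧ p = ([x, y], [y, x])}

/-- The congruence `≡_Γ`: the smallest equivalence relation containing `→_Γ`. -/
def GEquiv (Γ : GGraph V) : GWord V → GWord V → Prop :=
  Relation.EqvGen (RStep (GRules Γ))

/-- The graph monoid `MΓ = X_Γ*/≡_Γ`. -/
def GMonoid (Γ : GGraph V) := Quot (RStep (GRules Γ))

/-- The class `[w]` of a word `w` in `MΓ`. -/
def gmk (Γ : GGraph V) (w : GWord V) : GMonoid Γ := Quot.mk _ w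

/-- Runs of a valence system with transition set `E`: `Run E p w q` means
there is a sequence of transitions from `p` to `q` whose labels concatenate to `w`. -/
inductive Run (E : Set (Q × GWord V × Q)) : Q → GWord V → Q → Prop
  | nil (q : Q) : Run E q [] q
  | cons {p : Q} {w : GWord V} {q : Q} {u : GWord V} {r : Q} :
      (p, w, q) ∈ E → Run E q u r → Run E p (w ++ u) r

/-- A transition set is bidirected if for any transition `p →w q`
it also contains the transition `q →w̄ p`. -/
def Bidirected (E : Set (Q × GWord V × Q)) : Prop :=
  ∀ p w q, (p, w, q) ∈ E → (q, barW w, p) ∈ E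

/-- Every vertex of `Γ` carries a self-loop. -/
def Looped (Γ : GGraph V) : Prop := ∀ v, Γ.adj v v

/-- `Γ°`: the graph `Γ` with self-loops added on all vertices. -/
def loopify (Γ : GGraph V) : GGraph V :=
  ⟨fun a b => Γ.adj a b ∨ a = b, by
    intro u v h
    rcases h with h | h
    · exact Or.inl (Γ.symm u v h)
    · exact Or.inr h.symm⟩

end ValencePaper

open ValencePaper

namespace ValencePaper

theorem gmk_append_congr {V : Type} (Γ : GGraph V) {a b : GWord V} (x y : GWord V)
    (h : gmk Γ a = gmk Γ b) : gmk Γ (x ++ a ++ y) = gmk Γ (x ++ b ++ y) := by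
  have key : ∀ c : GWord V, gmk Γ (x ++ c ++ y) =
      Quot.lift (r := RStep (GRules Γ)) (fun c => gmk Γ (x ++ c ++ y))
        (by
          rintro _ _ ⟨s, t, hr⟩
          have h : gmk Γ _ = gmk Γ _ := Quot.sound (RStep.intro (x ++ s) (t ++ y) hr)
          simpa only [List.append_assoc] using h) (gmk Γ c) := fun _ => rfl
  rw [key a, key b, h]

theorem gmk_append_left {V : Type} (Γ : GGraph V) {a b : GWord V} (x : GWord V)
    (h : gmk Γ a = gmk Γ b) : gmk Γ (x ++ a) = gmk Γ (x ++ b) := by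
  simpa using gmk_append_congr Γ x [] h

theorem gmk_append_right {V : Type} (Γ : GGraph V) {a b : GWord V} (y : GWord V)
    (h : gmk Γ a = gmk Γ b) : gmk Γ (a ++ y) = gmk Γ (b ++ y) := by
  simpa using gmk_append_congr Γ [] y h

theorem barL_barL {V : Type} (x : XLetter V) : barL (barL x) = x := by
  cases x <;> rfl

theorem barW_barW {V : Type} (w : GWord V) : barW (barW w) = w := by
  simp [barW, Function.comp_def, barL_barL]

theorem gmk_letter_barL {V : Type} (Γ : GGraph V) (hloop : Looped Γ) (x : XLetter V) :
    gmk Γ [x, barL x] = gmk Γ [] := by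
  have cancel (v : V) : gmk Γ [Sum.inl v, Sum.inr v] = gmk Γ [] :=
    Quot.sound (RStep.intro (R := GRules Γ) [] [] (a := [Sum.inl v, Sum.inr v]) (b := [])
      (Or.inl ⟨v, rfl⟩))
  rcases x with v | v
  · exact cancel v
  · exact (Quot.sound (RStep.intro (R := GRules Γ) [] [] (a := [Sum.inr v, Sum.inl v])
      (b := [Sum.inl v, Sum.inr v]) (Or.inr ⟨v, v, Sum.inr v, Sum.inl v, Or.inr rfl,
        Or.inl rfl, hloop v, rfl⟩))).trans (cancel v)

theorem gmk_append_barW {V : Type} (Γ : GGraph V) (hloop : Looped Γ) (w : GWord V) :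
    gmk Γ (w ++ barW w) = gmk Γ [] := by
  induction w with
  | nil => rfl
  | cons x w ih =>
    have h := gmk_append_congr Γ [x] [barL x] ih
    have h' := h.trans (gmk_letter_barL Γ hloop x)
    simpa [barW] using h'

theorem gmk_barW_append {V : Type} (Γ : GGraph V) (hloop : Looped Γ) (w : GWord V) :
    gmk Γ (barW w ++ w) = gmk Γ [] := by
  simpa only [barW_barW] using gmk_append_barW Γ hloop (barW w)

theorem Run.loops {V Q : Type} {E : Set (Q × GWord V × Q)} {q : Q} {parts : List (GWord V)}
    (h : ∀ p ∈ parts, (q, p, q) ∈ E) : Run E q parts.flatten q := by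
  induction parts with
  | nil => exact Run.nil q
  | cons p ps ih =>
    rw [List.flatten_cons]
    exact Run.cons (h p (by simp)) (ih fun p' hp' => h p' (by simp [hp']))

/-- A potential on the states turns the label of a run into a product of labels from `P`,
provided every transition has such a factorization. -/
theorem Run.exists_parts {V Q : Type} (Γ : GGraph V) {E : Set (Q × GWord V × Q)}
    (P : GWord V → Prop) (pot : Q → GWord V)
    (hE : ∀ p x q, (p, x, q) ∈ E → ∃ parts : List (GWord V), (∀ y ∈ parts, P y) ∧
      gmk Γ (pot p ++ x) = gmk Γ (parts.flatten ++ pot q))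
    {p : Q} {u : GWord V} {q : Q} (h : Run E p u q) :
    ∃ parts : List (GWord V), (∀ y ∈ parts, P y) ∧
      gmk Γ (pot p ++ u) = gmk Γ (parts.flatten ++ pot q) := by
  induction h with
  | nil q => exact ⟨[], by simp, by simp⟩
  | @cons p x q u r he _ ih =>
    obtain ⟨l₁, hl₁, e₁⟩ := hE p x q he
    obtain ⟨l₂, hl₂, e₂⟩ := ih
    refine ⟨l₁ ++ l₂, fun y hy => (List.mem_append.1 hy).elim (hl₁ y) (hl₂ y), ?_⟩
    have h₁ := gmk_append_right Γ u e₁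
    have h₂ := gmk_append_left Γ l₁.flatten e₂
    simp only [List.append_assoc, List.flatten_append] at h₁ h₂ ⊢
    exact h₁.trans h₂

end ValencePaper

/-- Let `Γ` be looped and `w, w₁, …, w_k ∈ X_Γ*`. Let `A` be the
bidirected valence system over `Γ` with states `s = false`, `t = true` and
transitions `s →w̄ t`, `t →w s`, and `t →wᵢ t`, `t →w̄ᵢ t` for each `i`.
Then `[w] ∈ ⟨[w₁], …, [w_k]⟩` (i.e. `[w]` is a finite product of the `[wᵢ]`
and their inverses) iff there is a run `s →u t` in `A` with `[u] = 1`. -/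
theorem subgroup_membership_iff_bireach {V : Type} (Γ : GGraph V)
    (hloop : Looped Γ) (k : ℕ) (w : GWord V) (ws : Fin k → GWord V) :
    ∀ E : Set (Bool × GWord V × Bool),
      E = {x | x = (false, barW w, true) ∨ x = (true, w, false) ∨
               (∃ i : Fin k, x = (true, ws i, true) ∨ x = (true, barW (ws i), true))} →
      ((∃ parts : List (GWord V),
          (∀ p ∈ parts, (∃ i, p = ws i) ∨ (∃ i, p = barW (ws i))) ∧
          gmk Γ w = gmk Γ parts.flatten) ↔
        (∃ u : GWord V, Run E false u true ∧ gmk Γ u = gmk Γ [])) := by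
  rintro E rfl
  constructor
  · rintro ⟨parts, hparts, hw⟩
    refine ⟨barW w ++ parts.flatten, Run.cons (Or.inl rfl) (Run.loops fun p hp => ?_), ?_⟩
    · rcases hparts p hp with ⟨i, rfl⟩ | ⟨i, rfl⟩
      · exact Or.inr (Or.inr ⟨i, Or.inl rfl⟩)
      · exact Or.inr (Or.inr ⟨i, Or.inr rfl⟩)
    · exact (gmk_append_left Γ (barW w) hw).symm.trans (gmk_barW_append Γ hloop w)
  · rintro ⟨u, hrun, hu⟩
    obtain ⟨parts, hparts, h⟩ := Run.exists_parts Γ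
      (fun p => (∃ i, p = ws i) ∨ (∃ i, p = barW (ws i))) (fun b => if b then [] else w)
      (by
        rintro p x q (h | h | ⟨i, h | h⟩) <;> obtain ⟨rfl, rfl, rfl⟩ := h
        · exact ⟨[], by simp, by simpa using gmk_append_barW Γ hloop w⟩
        · exact ⟨[], by simp, by simp⟩
        · exact ⟨[ws i], fun y hy => Or.inl ⟨i, List.mem_singleton.1 hy⟩, by simp⟩
        · exact ⟨[barW (ws i)], fun y hy => Or.inr ⟨i, List.mem_singleton.1 hy⟩, by simp⟩) hrun
    refine ⟨parts, hparts, ?_⟩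
    have hwu := gmk_append_left Γ w hu
    simp only [List.append_nil] at hwu
    exact hwu.symm.trans (by simpa using h)
end

section
/- Let Γ be a graph with two non-adjacent vertices u and v where u is unlooped. If x ∈ X_Γ* satisfies x ≡_Γ ε, then x contains no factor (contiguous subword) of the form u v^i ū or u v̄^i ū with i ≥ 1. -/
open scoped Classical

open ValencePaper

namespace ValencePaper

variable {V : Type}

/-- The partial action of a letter on pairs of a counter and a stack of suspended counters:
`u` suspends the counter and starts a fresh one at `0`, `ū` resumes the last suspended counter
provided the current one is `0`, and `v`, `v̄` increment and decrement the counter. -/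
noncomputable def stackStep (u v : V) : XLetter V → ℤ × List ℤ → Option (ℤ × List ℤ)
  | Sum.inl a, (n, l) =>
      if a = u then some (0, n :: l) else if a = v then some (n + 1, l) else some (n, l)
  | Sum.inr a, (n, l) =>
      if a = u then
        match l with
        | [] => none
        | m :: l' => if n = 0 then some (m, l') else none
      else if a = v then some (n - 1, l) else some (n, l)

/-- The partial action of a word, reading from left to right. -/
noncomputable def stackRun (u v : V) (w : GWord V) (c : Option (ℤ × List ℤ)) :
    Option (ℤ × List ℤ) :=
  w.foldl (fun c x => c.bind (stackStep u v x)) c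

theorem stackRun_append (u v : V) (w w' : GWord V) (c : Option (ℤ × List ℤ)) :
    stackRun u v (w ++ w') c = stackRun u v w' (stackRun u v w c) :=
  List.foldl_append

theorem stackRun_none (u v : V) (w : GWord V) : stackRun u v w none = none := by
  induction w with
  | nil => rfl
  | cons x w ih => exact ih

theorem stackStep_of_vtx_ne {u v : V} {x : XLetter V} (hu : vtx x ≠ u) (hv : vtx x ≠ v) :
    stackStep u v x = some := by
  rcases x with a | a <;> simp only [vtx, Sum.elim_inl, Sum.elim_inr, id] at hu hv <;>
    funext c <;> simp [stackStep, hu, hv]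

theorem stackStep_cancel (u v a : V) (c : ℤ × List ℤ) :
    (stackStep u v (Sum.inl a) c).bind (stackStep u v (Sum.inr a)) = some c := by
  by_cases hau : a = u
  · simp [stackStep, hau]
  · by_cases hav : a = v
    · subst hav
      simp [stackStep, hau]
    · simp [stackStep, hau, hav]

theorem stackStep_comm {u v : V} {x y : XLetter V} (h : vtx x = v → vtx y ≠ u)
    (hx : vtx x = u → vtx y ≠ u ∧ vtx y ≠ v) (c : ℤ × List ℤ) :
    (stackStep u v x c).bind (stackStep u v y) = (stackStep u v y c).bind (stackStep u v x) := by
  by_cases hxuv : vtx x ≠ u ∧ vtx x ≠ v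
  · simp [stackStep_of_vtx_ne hxuv.1 hxuv.2]
  by_cases hyuv : vtx y ≠ u ∧ vtx y ≠ v
  · simp [stackStep_of_vtx_ne hyuv.1 hyuv.2]
  have hxu : vtx x ≠ u := fun e => hyuv (hx e)
  have hxv : vtx x = v := not_not.mp fun e => hxuv ⟨hxu, e⟩
  have hyu : vtx y ≠ u := h hxv
  have hyv : vtx y = v := not_not.mp fun e => hyuv ⟨hyu, e⟩
  rcases x with a | a <;> rcases y with b | b <;>
    simp only [vtx, Sum.elim_inl, Sum.elim_inr, id] at hxu hxv hyu hyv <;>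
    subst hxv <;> subst hyv <;> simp [stackStep, hxu]

theorem stackRun_rule {Γ : GGraph V} {u v : V} (hnadj : ¬ Γ.adj u v) (hunl : ¬ Γ.adj u u)
    {w w' : GWord V} (h : (w, w') ∈ GRules Γ) (c : Option (ℤ × List ℤ)) :
    stackRun u v w c = stackRun u v w' c := by
  rcases c with _ | c
  · simp only [stackRun_none]
  rcases h with ⟨a, h⟩ | ⟨a, b, x, y, hx, hy, hab, h⟩
  · obtain ⟨rfl, rfl⟩ := Prod.mk.inj h
    exact stackStep_cancel u v a c
  · obtain ⟨rfl, rfl⟩ := Prod.mk.inj h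
    have hxa : vtx x = a := by rcases hx with rfl | rfl <;> rfl
    have hyb : vtx y = b := by rcases hy with rfl | rfl <;> rfl
    subst hxa hyb
    exact stackStep_comm
      (fun hv hu => hnadj (Γ.symm _ _ (by rwa [hv, hu] at hab)))
      (fun hu => ⟨fun hu' => hunl (by rwa [hu, hu'] at hab),
        fun hv => hnadj (by rwa [hu, hv] at hab)⟩) c

theorem stackRun_eq_of_gequiv {Γ : GGraph V} {u v : V} (hnadj : ¬ Γ.adj u v)
    (hunl : ¬ Γ.adj u u) {x y : GWord V} (h : GEquiv Γ x y) (c : Option (ℤ × List ℤ)) :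
    stackRun u v x c = stackRun u v y c := by
  induction h with
  | rel x y h =>
    obtain ⟨s, t, h⟩ := h
    simp only [stackRun_append, stackRun_rule hnadj hunl h]
  | refl x => rfl
  | symm x y _ ih => exact ih.symm
  | trans x y z _ _ ih₁ ih₂ => exact ih₁.trans ih₂

theorem stackRun_replicate_inl {u v : V} (huv : u ≠ v) (i : ℕ) (n : ℤ) (l : List ℤ) :
    stackRun u v (List.replicate i (Sum.inl v)) (some (n, l)) = some (n + i, l) := by
  induction i generalizing n with
  | zero => simp [stackRun]
  | succ i ih =>
    have h : stackRun u v (List.replicate (i + 1) (Sum.inl v)) (some (n, l)) =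
        stackRun u v (List.replicate i (Sum.inl v)) (some (n + 1, l)) := by
      simp [List.replicate_succ, stackRun, stackStep, huv.symm]
    rw [h, ih]
    push_cast
    ring_nf

theorem stackRun_replicate_inr {u v : V} (huv : u ≠ v) (i : ℕ) (n : ℤ) (l : List ℤ) :
    stackRun u v (List.replicate i (Sum.inr v)) (some (n, l)) = some (n - i, l) := by
  induction i generalizing n with
  | zero => simp [stackRun]
  | succ i ih =>
    have h : stackRun u v (List.replicate (i + 1) (Sum.inr v)) (some (n, l)) =
        stackRun u v (List.replicate i (Sum.inr v)) (some (n - 1, l)) := by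
      simp [List.replicate_succ, stackRun, stackStep, huv.symm]
    rw [h, ih]
    push_cast
    ring_nf

/-- A word between `u` and `ū` that moves the counter from `0` to a nonzero value blocks the
action. -/
theorem stackRun_factor_eq_none {u v : V} {w : GWord V} {k : ℤ} (hk : k ≠ 0)
    (hw : ∀ l, stackRun u v w (some (0, l)) = some (k, l)) (c : Option (ℤ × List ℤ)) :
    stackRun u v (Sum.inl u :: (w ++ [Sum.inr u])) c = none := by
  rcases c with _ | ⟨n, l⟩
  · exact stackRun_none u v _
  have h : stackRun u v (Sum.inl u :: (w ++ [Sum.inr u])) (some (n, l)) =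
      stackRun u v [Sum.inr u] (stackRun u v w (some (0, n :: l))) := by
    rw [← stackRun_append]
    simp [stackRun, stackStep]
  rw [h, hw]
  simp [stackRun, stackStep, hk]

theorem ne_of_gequiv_nil {Γ : GGraph V} {u v : V} (hnadj : ¬ Γ.adj u v) (hunl : ¬ Γ.adj u u)
    {x w : GWord V} (hx : GEquiv Γ x []) {k : ℤ} (hk : k ≠ 0)
    (hw : ∀ l, stackRun u v w (some (0, l)) = some (k, l)) (s t : GWord V) :
    x ≠ s ++ (Sum.inl u :: (w ++ [Sum.inr u])) ++ t := by
  rintro rfl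
  have h := stackRun_eq_of_gequiv hnadj hunl hx (some (0, []))
  rw [stackRun_append, stackRun_append, stackRun_factor_eq_none hk hw, stackRun_none] at h
  exact absurd h.symm (Option.some_ne_none _)

end ValencePaper

/-- Let `Γ` have two non-adjacent vertices `u, v` with `u` unlooped.
If `x ≡_Γ ε`, then `x` contains no factor of the form `u v^i ū` or `u v̄^i ū`
with `i ≥ 1`. -/
theorem no_uvu_factor {V : Type} (Γ : GGraph V) (u v : V) (huv : u ≠ v)
    (hnadj : ¬ Γ.adj u v) (hunl : ¬ Γ.adj u u) :
    ∀ x : GWord V, GEquiv Γ x [] →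
      ∀ (i : ℕ), 1 ≤ i → ∀ s t : GWord V,
        x ≠ s ++ (Sum.inl u :: (List.replicate i (Sum.inl v) ++ [Sum.inr u])) ++ t ∧
        x ≠ s ++ (Sum.inl u :: (List.replicate i (Sum.inr v) ++ [Sum.inr u])) ++ t := by
  intro x hx i hi s t
  have hi' : (i : ℤ) ≠ 0 := by omega
  exact ⟨ne_of_gequiv_nil hnadj hunl hx (k := i) hi'
      (fun l => by simp [stackRun_replicate_inl huv]) s t,
    ne_of_gequiv_nil hnadj hunl hx (k := -i) (neg_ne_zero.mpr hi')
      (fun l => by simp [stackRun_replicate_inr huv]) s t⟩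
end

section
/- Let A ∈ ℤ^{m×n} be a matrix with columns a₁, …, a_n ∈ ℤ^m and let b ∈ ℤ^m. Let Γ_m be the looped clique with vertices v₁, …, v_m (every pair of distinct vertices adjacent, every vertex looped), and let φ : ℤ^m → X_{Γ_m}* map (k₁, …, k_m) to v₁^{k₁} ⋯ v_m^{k_m}, where v^k denotes v repeated k times if k ≥ 0 and v̄ repeated −k times if k < 0. Let A be the bidirected valence system over Γ_m with two states p, q, the transitions p →φ(a_i) p for i ∈ [1,n] and p →φ(b)‾ q, and their reverse transitions. Then the system A x = b has a solution x ∈ ℤ^n if and only if there exists w ∈ X_{Γ_m}* with [w] = 1 and a run p →w q in A. -/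
open scoped Classical

namespace ValencePaper

/-- `v^k`: the letter `v` repeated `k` times if `k ≥ 0`, and `v̄` repeated
`−k` times if `k < 0`. -/
def zrep {V : Type} (v : V) (z : ℤ) : GWord V :=
  if 0 ≤ z then List.replicate z.toNat (Sum.inl v) else List.replicate (-z).toNat (Sum.inr v)

/-- `φ(k₁, …, k_m) = v₁^{k₁} ⋯ v_m^{k_m}` over the looped clique on `Fin m`. -/
def zword (m : ℕ) (k : Fin m → ℤ) : GWord (Fin m) :=
  ((List.finRange m).map fun i => zrep i (k i)).flatten

/-- The looped clique on `Fin m`: all vertices pairwise adjacent and looped. -/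
def loopedClique (m : ℕ) : GGraph (Fin m) := ⟨fun _ _ => True, fun _ _ h => h⟩

end ValencePaper

namespace ValencePaper

section Monoid

variable {V : Type}

theorem gmk_congr (Γ : GGraph V) (s t : GWord V) {u u' : GWord V} (h : gmk Γ u = gmk Γ u') :
    gmk Γ (s ++ u ++ t) = gmk Γ (s ++ u' ++ t) := by
  induction Quot.eqvGen_exact h with
  | rel a b hab =>
    obtain ⟨s', t', hr⟩ := hab
    have := RStep.intro (s ++ s') (t' ++ t) hr
    simp only [List.append_assoc] at this ⊢
    exact Quot.sound this
  | refl => rfl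
  | symm a b _ ih => exact (ih (Quot.eqvGen_sound ‹_›)).symm
  | trans a b c h₁ h₂ ih₁ ih₂ =>
    exact (ih₁ (Quot.eqvGen_sound h₁)).trans (ih₂ (Quot.eqvGen_sound h₂))

theorem gmk_cancel (Γ : GGraph V) (v : V) (w : GWord V) :
    gmk Γ (Sum.inl v :: Sum.inr v :: w) = gmk Γ w :=
  Quot.sound (RStep.intro (R := GRules Γ) [] w (a := [Sum.inl v, Sum.inr v]) (b := [])
    (Or.inl ⟨v, rfl⟩))

theorem gmk_swap (Γ : GGraph V) (x y : XLetter V) (h : Γ.adj (vtx x) (vtx y)) (w : GWord V) :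
    gmk Γ (x :: y :: w) = gmk Γ (y :: x :: w) :=
  Quot.sound (RStep.intro (R := GRules Γ) [] w (a := [x, y]) (b := [y, x])
    (Or.inr ⟨vtx x, vtx y, x, y, by cases x <;> simp [vtx],
      by cases y <;> simp [vtx], h, rfl⟩))

theorem gmk_eq_of_perm (Γ : GGraph V) (hΓ : ∀ u v, Γ.adj u v) {w w' : GWord V}
    (h : w.Perm w') : gmk Γ w = gmk Γ w' := by
  induction h with
  | nil => rfl
  | cons x _ ih => simpa using gmk_congr Γ [x] [] ih
  | swap x y l => exact gmk_swap Γ y x (hΓ _ _) l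
  | trans _ _ ih₁ ih₂ => exact ih₁.trans ih₂

theorem barL_injective : Function.Injective (barL : XLetter V → XLetter V) := by
  rintro (a | a) (b | b) h <;> simp_all [barL]

end Monoid

section Weight

instance {α β : Type} [BEq α] [BEq β] [LawfulBEq α] [LawfulBEq β] : LawfulBEq (α ⊕ β) where
  rfl {a} := by
    rcases a with a | a
    · change (a == a) = true; simp
    · change (a == a) = true; simp
  eq_of_beq {a b} h := by
    rcases a with a | a <;> rcases b with b | b
    · exact congrArg Sum.inl (eq_of_beq (show (a == b) = true from h))
    · exact absurd h Bool.false_ne_true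
    · exact absurd h Bool.false_ne_true
    · exact congrArg Sum.inr (eq_of_beq (show (a == b) = true from h))

variable {V : Type} [DecidableEq V]

/-- The exponent sum of each vertex in a word. -/
def expSum (w : GWord V) (v : V) : ℤ :=
  (w.count (Sum.inl v) : ℤ) - w.count (Sum.inr v)

@[simp] theorem expSum_nil : expSum ([] : GWord V) = 0 := by
  ext v; simp [expSum]

@[simp] theorem expSum_append (u w : GWord V) : expSum (u ++ w) = expSum u + expSum w := by
  ext v; simp only [expSum, List.count_append, Pi.add_apply]; push_cast; ring

@[simp] theorem expSum_barW (w : GWord V) : expSum (barW w) = -expSum w := by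
  ext v
  have h₁ := List.count_map_of_injective w barL barL_injective (Sum.inl v)
  have h₂ := List.count_map_of_injective w barL barL_injective (Sum.inr v)
  simp only [barL, Sum.elim_inl, Sum.elim_inr] at h₁ h₂
  simp only [expSum, barW, List.count_reverse, Pi.neg_apply]
  unfold barL
  rw [h₁, h₂]; ring

theorem expSum_zrep (v : V) (z : ℤ) : expSum (zrep v z) = Pi.single v z := by
  ext u
  unfold zrep expSum
  by_cases huv : v = u
  · subst huv
    split_ifs <;> simp [List.count_replicate] <;> omega
  · split_ifs <;> simp [List.count_replicate, huv, Ne.symm huv]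

theorem expSum_flatten (l : List (GWord V)) : expSum l.flatten = (l.map expSum).sum := by
  induction l with
  | nil => simp
  | cons a l ih => simp [ih]

@[simp] theorem expSum_zword (m : ℕ) (k : Fin m → ℤ) : expSum (zword m k) = k := by
  rw [zword, expSum_flatten, List.map_map]
  have : expSum ∘ (fun i => zrep i (k i)) = fun i => (Pi.single i (k i) : Fin m → ℤ) :=
    funext fun i => expSum_zrep i (k i)
  rw [this, ← List.ofFn_eq_map, List.sum_ofFn, Finset.univ_sum_single]

theorem expSum_eq_of_gmk_eq (Γ : GGraph V) {w w' : GWord V}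
    (h : gmk Γ w = gmk Γ w') : expSum w = expSum w' := by
  refine congrArg (Quot.lift expSum ?_) h
  rintro _ _ ⟨s, t, ⟨v, hv⟩ | ⟨a, b, x, y, -, -, -, hxy⟩⟩
  · obtain ⟨rfl, rfl⟩ := Prod.mk.inj hv
    have : expSum ([Sum.inl v, Sum.inr v] : GWord V) = 0 := by
      ext u; simp [expSum, List.count_cons]
    simp only [expSum_append, this, expSum_nil]
  · obtain ⟨rfl, rfl⟩ := Prod.mk.inj hxy
    have : expSum [x, y] = expSum [y, x] := by
      ext u; simp only [expSum, (List.Perm.swap y x []).count_eq]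
    simp only [expSum_append, this]

theorem gmk_eq_nil_of_expSum_eq_zero (Γ : GGraph V) (hΓ : ∀ u v, Γ.adj u v) (w : GWord V)
    (h : expSum w = 0) : gmk Γ w = gmk Γ [] := by
  match w, h with
  | [], _ => rfl
  | x :: w, h =>
    have hv : ∃ v, Sum.inl v ∈ x :: w ∧ Sum.inr v ∈ x :: w := by
      refine ⟨vtx x, ?_⟩
      have h₀ : (x :: w).count (Sum.inl (vtx x)) = (x :: w).count (Sum.inr (vtx x)) := by
        have := congrFun h (vtx x)
        simp only [expSum, Pi.zero_apply] at this
        omega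
      rw [← List.count_pos_iff, ← List.count_pos_iff, h₀, and_self]
      cases x with
      | inl v => rw [← h₀]; simp [vtx]
      | inr v => simp [vtx]
    obtain ⟨v, hl, hr⟩ := hv
    have hperm : (x :: w).Perm (Sum.inl v :: Sum.inr v ::
        ((x :: w).erase (Sum.inl v)).erase (Sum.inr v)) :=
      (List.perm_cons_erase hl).trans
        (.cons _ (List.perm_cons_erase ((List.mem_erase_of_ne (by simp)).2 hr)))
    have hg := (gmk_eq_of_perm Γ hΓ hperm).trans (gmk_cancel Γ v _)
    rw [hg]
    have hlen := hperm.length_eq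
    exact gmk_eq_nil_of_expSum_eq_zero Γ hΓ _ ((expSum_eq_of_gmk_eq Γ hg).symm.trans h)
termination_by w.length
decreasing_by simp only [List.length_cons] at hlen ⊢; omega

end Weight

section Runs

variable {Q : Type} {V : Type} {E : Set (Q × GWord V × Q)}

theorem Run.append {p q r : Q} {u w : GWord V} (h : Run E p u q) (h' : Run E q w r) :
    Run E p (u ++ w) r := by
  induction h with
  | nil => exact h'
  | cons he _ ih => rw [List.append_assoc]; exact .cons he (ih h')

theorem Run.single {p q : Q} {w : GWord V} (h : (p, w, q) ∈ E) : Run E p w q := by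
  simpa using Run.cons h (.nil q)

variable {m n : ℕ} {A : Matrix (Fin m) (Fin n) ℤ}

/-- If the label of every transition is an integer combination of the columns of `A` up to a
potential difference, then so is the label of every run. -/
theorem Run.exists_expSum_eq {E : Set (Q × GWord (Fin m) × Q)} (pot : Q → Fin m → ℤ)
    (hE : ∀ p w q, (p, w, q) ∈ E → ∃ x, expSum w = A.mulVec x + pot p - pot q)
    {p q : Q} {w : GWord (Fin m)} (h : Run E p w q) :
    ∃ x, expSum w = A.mulVec x + pot p - pot q := by
  induction h with
  | nil q => exact ⟨0, by simp⟩
  | cons he _ ih =>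
    obtain ⟨x, hx⟩ := hE _ _ _ he
    obtain ⟨y, hy⟩ := ih
    exact ⟨x + y, by rw [expSum_append, hx, hy, Matrix.mulVec_add]; abel⟩

/-- Loops reading the columns of `A` and their inverses realize every integer combination. -/
theorem exists_run_expSum_eq_mulVec {E : Set (Q × GWord (Fin m) × Q)} {p : Q}
    (hpos : ∀ i, (p, zword m (fun j => A j i), p) ∈ E)
    (hneg : ∀ i, (p, barW (zword m (fun j => A j i)), p) ∈ E) (x : Fin n → ℤ) :
    ∃ w, Run E p w p ∧ expSum w = A.mulVec x := by
  have hadd : ∀ x y : Fin n → ℤ, (∃ w, Run E p w p ∧ expSum w = A.mulVec x) →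
      (∃ w, Run E p w p ∧ expSum w = A.mulVec y) →
      ∃ w, Run E p w p ∧ expSum w = A.mulVec (x + y) := by
    rintro x y ⟨u, hu, hu'⟩ ⟨w, hw, hw'⟩
    exact ⟨u ++ w, hu.append hw, by rw [expSum_append, hu', hw', Matrix.mulVec_add]⟩
  have hzero : ∃ w, Run E p w p ∧ expSum w = A.mulVec 0 := ⟨[], .nil p, by simp⟩
  have hcol : ∀ i, A.mulVec (Pi.single i 1) = fun j => A j i := fun i => by
    ext j; simp
  rw [← Finset.univ_sum_single x]
  refine Finset.sum_induction _ (fun x => ∃ w, Run E p w p ∧ expSum w = A.mulVec x)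
    hadd hzero fun i _ => ?_
  induction x i using Int.induction_on with
  | zero => simpa using hzero
  | succ k ih =>
    rw [Pi.single_add]
    exact hadd _ _ ih ⟨_, .single (hpos i), by rw [expSum_zword, hcol]⟩
  | pred k ih =>
    rw [sub_eq_add_neg, Pi.single_add]
    exact hadd _ _ ih ⟨_, .single (hneg i), by
      rw [expSum_barW, expSum_zword, Pi.single_neg, Matrix.mulVec_neg, hcol]⟩

end Runs

end ValencePaper

open ValencePaper

/-- For `A ∈ ℤ^{m×n}` with columns `a₁,…,a_n` and `b ∈ ℤ^m`, let
`𝒜` be the bidirected valence system over the looped clique `Γ_m` with states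
`p = false`, `q = true`, transitions `p →φ(aᵢ) p` and `p →φ(b)‾ q`, and their
reverse transitions. Then `A x = b` has a solution `x ∈ ℤ^n` iff there is
`w ∈ X_{Γ_m}*` with `[w] = 1` and a run `p →w q`. -/
theorem diophantine_iff_bireach (m n : ℕ) (A : Matrix (Fin m) (Fin n) ℤ)
    (b : Fin m → ℤ) :
    ∀ E : Set (Bool × GWord (Fin m) × Bool),
      E = {x | (∃ i : Fin n, x = (false, zword m (fun j => A j i), false) ∨
                 x = (false, barW (zword m (fun j => A j i)), false)) ∨
               x = (false, barW (zword m b), true) ∨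
               x = (true, barW (barW (zword m b)), false)} →
      ((∃ x : Fin n → ℤ, A.mulVec x = b) ↔
        ∃ w : GWord (Fin m), gmk (loopedClique m) w = gmk (loopedClique m) [] ∧
          Run E false w true) := by
  rintro E rfl
  constructor
  · rintro ⟨x, rfl⟩
    obtain ⟨w, hw, hx⟩ := exists_run_expSum_eq_mulVec (A := A)
      (E := {e | (∃ i : Fin n, e = (false, zword m (fun j => A j i), false) ∨
                 e = (false, barW (zword m (fun j => A j i)), false)) ∨
               e = (false, barW (zword m (A.mulVec x)), true) ∨
               e = (true, barW (barW (zword m (A.mulVec x))), false)})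
      (fun i => Or.inl ⟨i, Or.inl rfl⟩) (fun i => Or.inl ⟨i, Or.inr rfl⟩) x
    refine ⟨w ++ barW (zword m (A.mulVec x)),
      gmk_eq_nil_of_expSum_eq_zero _ (fun _ _ => trivial) _ ?_,
      hw.append (.single (Or.inr (Or.inl rfl)))⟩
    rw [expSum_append, hx, expSum_barW, expSum_zword, add_neg_cancel]
  · rintro ⟨w, hw, hrun⟩
    have hw₀ : expSum w = 0 := (expSum_eq_of_gmk_eq _ hw).trans expSum_nil
    have hcol : ∀ i, A.mulVec (Pi.single i 1) = fun j => A j i := fun i => by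
      ext j; simp
    obtain ⟨x, hx⟩ := hrun.exists_expSum_eq (A := A) (fun s => if s then b else 0) (by
      rintro p w q (⟨i, h | h⟩ | h | h) <;> obtain ⟨rfl, rfl, rfl⟩ := by simpa using h
      · exact ⟨Pi.single i 1, by simp [hcol]⟩
      · exact ⟨-Pi.single i 1, by simp [hcol, Matrix.mulVec_neg]⟩
      · exact ⟨0, by simp⟩
      · exact ⟨0, by simp⟩)
    refine ⟨x, ?_⟩
    rw [hw₀] at hx
    simpa [sub_eq_zero] using hx.symm
end
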